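/- arXiv:2003.11721 — 3 statements merged into one kernel-verified Lean document; each statement's English description precedes it below -/
import Mathlib

section
/- Let H : ℝ → ℝ be continuously differentiable and satisfy H(t) > 0 and H(t) + 2 t H'(t) > 0 for all t ≥ 0. Define F : ℝ³ → ℝ by F(p) = (1/2) ∫₀^{|p|²} H(τ) dτ. Then F is a convex function on ℝ³. -/
open MeasureTheory

open Set in
/-- Postcomposing the norm with a function that is convex and monotone on `[0, ∞)` gives a convex
function. -/
theorem ConvexOn.comp_norm {E : Type*} [NormedAddCommGroup E] [NormedSpace ℝ E] [Nontrivial E]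
    {g : ℝ → ℝ} (hg : ConvexOn ℝ (Ici 0) g) (hg' : MonotoneOn g (Ici 0)) :
    ConvexOn ℝ univ (fun p : E => g ‖p‖) := by
  have himage : (norm : E → ℝ) '' univ = Ici 0 := by
    rw [image_univ, range_norm]
  exact ConvexOn.comp (himage ▸ hg) convexOn_univ_norm (himage ▸ hg')

/-- The chain rule for `r ↦ (1/2) ∫₀^{r²} H`. -/
theorem hasDerivAt_half_integral_sq {H : ℝ → ℝ} (hH : Continuous H) (r : ℝ) :
    HasDerivAt (fun r : ℝ => (1 / 2) * ∫ τ in (0 : ℝ)..(r ^ 2), H τ) (r * H (r ^ 2)) r := by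
  have h := ((hH.integral_hasStrictDerivAt 0 (r ^ 2)).hasDerivAt.comp r
    (hasDerivAt_pow 2 r)).const_mul (1 / 2)
  refine h.congr_deriv ?_
  norm_num
  ring

theorem hasDerivAt_mul_comp_sq {H : ℝ → ℝ} (hH : Differentiable ℝ H) (r : ℝ) :
    HasDerivAt (fun r : ℝ => r * H (r ^ 2)) (H (r ^ 2) + 2 * r ^ 2 * deriv H (r ^ 2)) r := by
  have h := (hasDerivAt_id r).mul ((hH (r ^ 2)).hasDerivAt.comp r (hasDerivAt_pow 2 r))
  refine h.congr_deriv ?_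
  simp only [id, Function.comp]
  push_cast
  ring

/-- Convexity of the integrand `p ↦ F(|p|²)` of the variational functional, where
`F(r) = (1/2) ∫₀^r H(τ) dτ` and `H` is positive and satisfies `H(t) + 2tH'(t) > 0`
for `t ≥ 0`. -/
theorem convexity_of_truncated_integrand
    (H : ℝ → ℝ) (hH : ContDiff ℝ 1 H)
    (hHpos : ∀ t : ℝ, 0 ≤ t → 0 < H t)
    (hHell : ∀ t : ℝ, 0 ≤ t → 0 < H t + 2 * t * deriv H t) :
    ConvexOn ℝ Set.univ
      (fun p : EuclideanSpace ℝ (Fin 3) => (1/2) * ∫ τ in (0:ℝ)..(‖p‖^2), H τ) := by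
  have hd := hasDerivAt_half_integral_sq hH.continuous
  have hd' := hasDerivAt_mul_comp_sq (hH.differentiable one_ne_zero)
  have hcont : ContinuousOn (fun r : ℝ => (1 / 2) * ∫ τ in (0 : ℝ)..(r ^ 2), H τ) (Set.Ici 0) :=
    fun r _ => (hd r).continuousAt.continuousWithinAt
  refine ConvexOn.comp_norm (g := fun r => (1 / 2) * ∫ τ in (0 : ℝ)..(r ^ 2), H τ) ?_ ?_
  · exact convexOn_of_hasDerivWithinAt2_nonneg (convex_Ici 0) hcont
      (fun r _ => (hd r).hasDerivWithinAt) (fun r _ => (hd' r).hasDerivWithinAt)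
      (fun r _ => (hHell _ (sq_nonneg r)).le)
  · refine monotoneOn_of_hasDerivWithinAt_nonneg (convex_Ici 0) hcont
      (fun r _ => (hd r).hasDerivWithinAt) (fun r hr => ?_)
    exact mul_nonneg (interior_subset hr) (hHpos _ (sq_nonneg r)).le
end

section
/- Let t₁ ≤ t₂, h > 0, β > 0, and define ζ : ℝ → ℝ by ζ(x) = 1 for x ≤ t₁ − h; ζ(x) = e^{β(x − t₁ + h)} for t₁ − h < x ≤ t₁; ζ(x) = e^{βh} for t₁ < x ≤ t₂; ζ(x) = e^{βh} e^{−β(x − t₂)} for t₂ < x ≤ t₂ + h; and ζ(x) = 1 for x > t₂ + h. Let G : ℝ → [0, ∞) be integrable on [t₁ − h, t₂ + h] and suppose that ∫_{t₁−h}^{t₂+h} G(x)(ζ(x) − 1) dx ≤ ∫_{(t₁−h, t₁] ∪ (t₂, t₂+h]} G(x) ζ(x) dx. Then e^{βh} ∫_{t₁}^{t₂} G(x) dx ≤ ∫_{t₁−h}^{t₂+h} G(x) dx. -/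
open MeasureTheory

/-- The exponential weight `ζ` used in the weighted energy estimates. -/
noncomputable def zeta (t₁ t₂ h β x : ℝ) : ℝ :=
  if x ≤ t₁ - h then 1
  else if x ≤ t₁ then Real.exp (β * (x - t₁ + h))
  else if x ≤ t₂ then Real.exp (β * h)
  else if x ≤ t₂ + h then Real.exp (β * h) * Real.exp (-β * (x - t₂))
  else 1

theorem measurable_zeta (t₁ t₂ h β : ℝ) : Measurable (zeta t₁ t₂ h β) := by
  unfold zeta
  refine Measurable.ite measurableSet_Iic measurable_const ?_
  refine Measurable.ite measurableSet_Iic (by fun_prop) ?_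
  refine Measurable.ite measurableSet_Iic measurable_const ?_
  exact Measurable.ite measurableSet_Iic (by fun_prop) measurable_const

theorem norm_zeta_le {t₁ t₂ h β : ℝ} (hh : 0 ≤ h) (hβ : 0 ≤ β) (x : ℝ) :
    ‖zeta t₁ t₂ h β x‖ ≤ Real.exp (β * h) := by
  have one_le : 1 ≤ Real.exp (β * h) := Real.one_le_exp (mul_nonneg hβ hh)
  unfold zeta
  split_ifs
  · simpa using one_le
  · rw [Real.norm_eq_abs, Real.abs_exp, Real.exp_le_exp]
    nlinarith
  · rw [Real.norm_eq_abs, Real.abs_exp]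
  · rw [← Real.exp_add, Real.norm_eq_abs, Real.abs_exp, Real.exp_le_exp]
    nlinarith
  · simpa using one_le

theorem zeta_eq_on_plateau {t₁ t₂ h β x : ℝ} (hh : 0 ≤ h) (hx : x ∈ Set.Ioc t₁ t₂) :
    zeta t₁ t₂ h β x = Real.exp (β * h) := by
  have hx₁ := hx.1
  rw [zeta, if_neg (by linarith), if_neg (by linarith), if_pos hx.2]

/-- Hole-filling inequality: if the weighted energy inequality
`∫ G (ζ−1) ≤ ∫_{ramps} G ζ` holds for the weight `ζ`, then
`e^{βh} ∫_{t₁}^{t₂} G ≤ ∫_{t₁−h}^{t₂+h} G`. -/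
theorem hole_filling_inequality
    (t₁ t₂ h β : ℝ) (ht : t₁ ≤ t₂) (hh : 0 < h) (hβ : 0 < β)
    (G : ℝ → ℝ) (hG0 : ∀ x, 0 ≤ G x)
    (hGint : IntegrableOn G (Set.Icc (t₁ - h) (t₂ + h)))
    (hyp : (∫ x in Set.Icc (t₁ - h) (t₂ + h), G x * (zeta t₁ t₂ h β x - 1))
        ≤ ∫ x in Set.Ioc (t₁ - h) t₁ ∪ Set.Ioc t₂ (t₂ + h), G x * zeta t₁ t₂ h β x) :
    Real.exp (β * h) * ∫ x in Set.Icc t₁ t₂, G x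
      ≤ ∫ x in Set.Icc (t₁ - h) (t₂ + h), G x := by
  have hGζ : IntegrableOn (fun x ↦ G x * zeta t₁ t₂ h β x) (Set.Icc (t₁ - h) (t₂ + h)) :=
    hGint.mul_bdd (measurable_zeta t₁ t₂ h β).aestronglyMeasurable
      (ae_of_all _ (norm_zeta_le hh.le hβ.le))
  have hcover : Set.Ioc (t₁ - h) (t₂ + h)
      = (Set.Ioc (t₁ - h) t₁ ∪ Set.Ioc t₂ (t₂ + h)) ∪ Set.Ioc t₁ t₂ := by
    rw [Set.union_right_comm, Set.Ioc_union_Ioc_eq_Ioc (by linarith) ht,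
      Set.Ioc_union_Ioc_eq_Ioc (by linarith) (by linarith)]
  have hdisj : Disjoint (Set.Ioc (t₁ - h) t₁ ∪ Set.Ioc t₂ (t₂ + h)) (Set.Ioc t₁ t₂) := by
    rw [Set.disjoint_union_left]
    exact ⟨Set.Ioc_disjoint_Ioc_of_le le_rfl, (Set.Ioc_disjoint_Ioc_of_le le_rfl).symm⟩
  have hζIoc := hGζ.mono_set Set.Ioc_subset_Icc_self
  rw [hcover] at hζIoc
  have hplateau : ∫ x in Set.Ioc t₁ t₂, G x * zeta t₁ t₂ h β x
      = Real.exp (β * h) * ∫ x in Set.Ioc t₁ t₂, G x := by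
    rw [← integral_const_mul]
    refine setIntegral_congr_fun measurableSet_Ioc fun x hx ↦ ?_
    simp only [zeta_eq_on_plateau hh.le hx, mul_comm]
  have hsplit : ∫ x in Set.Icc (t₁ - h) (t₂ + h), G x * zeta t₁ t₂ h β x
      = (∫ x in Set.Ioc (t₁ - h) t₁ ∪ Set.Ioc t₂ (t₂ + h), G x * zeta t₁ t₂ h β x)
        + Real.exp (β * h) * ∫ x in Set.Ioc t₁ t₂, G x := by
    rw [integral_Icc_eq_integral_Ioc, hcover, setIntegral_union hdisj measurableSet_Ioc
      hζIoc.left_of_union hζIoc.right_of_union, hplateau]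
  simp only [mul_sub, mul_one] at hyp
  rw [integral_sub hGζ hGint, hsplit] at hyp
  rw [integral_Icc_eq_integral_Ioc (x := t₁)]
  linarith
end

section
/- Let ρ : ℝ → ℝ be continuously differentiable with ρ > 0 on [0, 1], let q̄ ∈ (0, 1), f̄ > 0, l > 0, c ≠ 0, C₀ > 0, and K > 0, and set m₀ = π f̄² ρ(q̄²) q̄. Define f(t) = f̄ + c t^{−l} for t > K and assume f(t) > 0 there. Let v : {x ∈ ℝ³ : x₃ > K} → ℝ³ be continuous with |v(x)| ≤ 1 and |v(x) − (0, 0, q̄)| ≤ C₀ x₃^{−l} for all x with x₃ > K, and suppose that for every t > K the flux identity ∫_{B_{f(t)}} ρ(|v(x', t)|²) v₃(x', t) dx' = m₀ holds, where B_r ⊂ ℝ² is the open disk of radius r centered at the origin. Then there exist constants C̃ > 0 and K' ≥ K such that for every t > K': sup_{x' ∈ B_{f(t)}} |v₃(x', t) − q̄| ≥ C̃ t^{−l}. -/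
open MeasureTheory

/-- Pointwise perturbation bound for the mass flux density `ρ(|v|²) v₃` around the
axial state `(0, 0, q)`. -/
lemma abs_flux_sub_le {ρ : ℝ → ℝ} {L M q s z b e : ℝ} (hL : 0 ≤ L)
    (hlip : ∀ x ∈ Set.Icc (0:ℝ) 1, ∀ y ∈ Set.Icc (0:ℝ) 1, |ρ x - ρ y| ≤ L * |x - y|)
    (hM : ∀ x ∈ Set.Icc (0:ℝ) 1, |ρ x| ≤ M)
    (hq0 : 0 ≤ q) (hq1 : q ≤ 1) (hs : s ∈ Set.Icc (0:ℝ) 1) (hz : |z| ≤ 1)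
    (hse : |s - z ^ 2| ≤ e) (hb : |z - q| ≤ b) :
    |ρ s * z - ρ (q ^ 2) * q| ≤ (M + 2 * L) * b + L * e := by
  have hb0 : 0 ≤ b := (abs_nonneg _).trans hb
  have hsq : |s - q ^ 2| ≤ e + 2 * b := by
    have h : |z ^ 2 - q ^ 2| ≤ 2 * b := by
      rw [show z ^ 2 - q ^ 2 = (z + q) * (z - q) by ring, abs_mul]
      refine mul_le_mul ?_ hb (abs_nonneg _) (by norm_num)
      exact (abs_add_le z q).trans (by rw [abs_of_nonneg hq0]; linarith)
    calc |s - q ^ 2| ≤ |s - z ^ 2| + |z ^ 2 - q ^ 2| := abs_sub_le _ _ _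
      _ ≤ e + 2 * b := add_le_add hse h
  have hρ : |ρ s - ρ (q ^ 2)| ≤ L * (e + 2 * b) :=
    (hlip s hs _ ⟨by positivity, by nlinarith⟩).trans (mul_le_mul_of_nonneg_left hsq hL)
  calc |ρ s * z - ρ (q ^ 2) * q| = |ρ s * (z - q) + (ρ s - ρ (q ^ 2)) * q| := by ring_nf
    _ ≤ |ρ s| * |z - q| + |ρ s - ρ (q ^ 2)| * q := by
      refine (abs_add_le _ _).trans_eq ?_
      rw [abs_mul, abs_mul, abs_of_nonneg hq0]
    _ ≤ M * b + L * (e + 2 * b) * 1 := by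
      refine add_le_add (mul_le_mul (hM s hs) hb (abs_nonneg _) ((abs_nonneg _).trans (hM s hs)))
        (mul_le_mul hρ hq1 hq0 ((abs_nonneg _).trans hρ))
    _ = (M + 2 * L) * b + L * e := by ring

/-- If a function on a planar disk of radius `r` has nonzero integral and is uniformly within
`D` of the constant `a`, then its integral is within `π r² D` of `π r² a`. -/
lemma abs_setIntegral_ball_sub_le {g : EuclideanSpace ℝ (Fin 2) → ℝ} {r a D m : ℝ} (hr : 0 ≤ r)
    (hint : ∫ x in Metric.ball (0 : EuclideanSpace ℝ (Fin 2)) r, g x = m) (hm : m ≠ 0)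
    (hg : ∀ x ∈ Metric.ball (0 : EuclideanSpace ℝ (Fin 2)) r, |g x - a| ≤ D) :
    |m - Real.pi * r ^ 2 * a| ≤ Real.pi * r ^ 2 * D := by
  have hgi : IntegrableOn g (Metric.ball (0 : EuclideanSpace ℝ (Fin 2)) r) :=
    Integrable.of_integral_ne_zero (by rwa [hint])
  have hvol : volume.real (Metric.ball (0 : EuclideanSpace ℝ (Fin 2)) r) = Real.pi * r ^ 2 := by
    rw [Measure.real, EuclideanSpace.volume_ball_fin_two]
    simp [hr, mul_comm, Real.pi_nonneg]
  have hfin : volume (Metric.ball (0 : EuclideanSpace ℝ (Fin 2)) r) < ⊤ := measure_ball_lt_top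
  have h := norm_setIntegral_le_of_norm_le_const (f := fun x => g x - a) hfin hg
  rw [integral_sub hgi (integrableOn_const hfin.ne), setIntegral_const, hint, hvol,
    Real.norm_eq_abs, smul_eq_mul] at h
  linarith

/-- Optimality of the convergence rate (Remark 1.2): if the nozzle radius is exactly
`f(t) = f̄ + c t^{−l}` with `c ≠ 0`, the velocity field `v` is continuous, uniformly
subsonic (`|v| ≤ 1`), converges to `(0,0,q̄)` at rate `t^{−l}`, and has constant mass
flux `m₀ = π f̄² ρ(q̄²) q̄` across every cross section, then the supremum of
`|v₃ − q̄|` over the cross section at height `t` is at least `C̃ t^{−l}` for large `t`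
(equivalently, every upper bound of `|v₃ − q̄|` on the cross section is `≥ C̃ t^{−l}`). -/
theorem optimal_convergence_rate
    (ρ : ℝ → ℝ) (hρ : ContDiff ℝ 1 ρ) (hρpos : ∀ t ∈ Set.Icc (0:ℝ) 1, 0 < ρ t)
    (qbar fbar l c C₀ K : ℝ)
    (hq0 : 0 < qbar) (hq1 : qbar < 1) (hfbar : 0 < fbar) (hl : 0 < l)
    (hc : c ≠ 0) (hC₀ : 0 < C₀) (hK : 0 < K)
    (f : ℝ → ℝ) (hf : ∀ t : ℝ, K < t → f t = fbar + c * t ^ (-l))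
    (hfpos : ∀ t : ℝ, K < t → 0 < f t)
    (v : EuclideanSpace ℝ (Fin 2) × ℝ → Fin 3 → ℝ)
    (hvcont : ContinuousOn v {x : EuclideanSpace ℝ (Fin 2) × ℝ | K < x.2})
    (hsub : ∀ x : EuclideanSpace ℝ (Fin 2) × ℝ, K < x.2 →
        Real.sqrt (∑ i : Fin 3, (v x i)^2) ≤ 1)
    (hrate : ∀ x : EuclideanSpace ℝ (Fin 2) × ℝ, K < x.2 →
        Real.sqrt ((v x 0)^2 + (v x 1)^2 + (v x 2 - qbar)^2) ≤ C₀ * x.2 ^ (-l))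
    (hflux : ∀ t : ℝ, K < t →
        (∫ x' in Metric.ball (0 : EuclideanSpace ℝ (Fin 2)) (f t),
            ρ (∑ i : Fin 3, (v (x', t) i)^2) * v (x', t) 2)
          = Real.pi * fbar^2 * ρ (qbar^2) * qbar) :
    ∃ Ct : ℝ, 0 < Ct ∧ ∃ K' : ℝ, K ≤ K' ∧ ∀ t : ℝ, K' < t →
      ∀ b : ℝ,
        (∀ x' ∈ Metric.ball (0 : EuclideanSpace ℝ (Fin 2)) (f t),
          |v (x', t) 2 - qbar| ≤ b) →
        Ct * t ^ (-l) ≤ b := by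
  have hI : Convex ℝ (Set.Icc (0:ℝ) 1) := convex_Icc 0 1
  obtain ⟨L, hLpos, hlip⟩ : ∃ L : ℝ, 0 < L ∧ ∀ x ∈ Set.Icc (0:ℝ) 1, ∀ y ∈ Set.Icc (0:ℝ) 1,
      |ρ x - ρ y| ≤ L * |x - y| := by
    obtain ⟨k, hk⟩ := hρ.contDiffOn.exists_lipschitzOnWith one_ne_zero hI isCompact_Icc
    refine ⟨k + 1, by positivity, fun x hx y hy => ?_⟩
    have h := hk.dist_le_mul x hx y hy
    rw [Real.dist_eq, Real.dist_eq] at h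
    nlinarith [abs_nonneg (x - y)]
  obtain ⟨M, hM⟩ := isCompact_Icc.exists_bound_of_continuousOn (hρ.continuous.continuousOn
    (s := Set.Icc (0:ℝ) 1))
  simp only [Real.norm_eq_abs] at hM
  have hM0 : 0 ≤ M := (abs_nonneg _).trans (hM 0 (by simp))
  have hρq : 0 < ρ (qbar ^ 2) := hρpos _ ⟨by positivity, by nlinarith⟩
  have hc' : 0 < |c| := abs_pos.mpr hc
  set A := ρ (qbar ^ 2) * qbar * |c| * fbar with hA
  set F := fbar + |c| with hF
  have hApos : 0 < A := by positivity
  have hFpos : 0 < F := by positivity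
  obtain ⟨T, hT⟩ := Filter.eventually_atTop.mp ((tendsto_rpow_neg_atTop hl).eventually
    (ge_mem_nhds (show 0 < min 1 (A / (2 * (F ^ 2 * L * C₀ ^ 2))) by positivity)))
  refine ⟨A / (2 * (F ^ 2 * (M + 2 * L))), by positivity, max K T, le_max_left _ _, ?_⟩
  intro t ht b hb
  have hKt : K < t := (le_max_left _ _).trans_lt ht
  obtain ⟨hε1, hε2⟩ := le_min_iff.mp (hT t ((le_max_right _ _).trans ht.le))
  have hεpos : 0 < t ^ (-l) := Real.rpow_pos_of_pos (hK.trans hKt) _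
  have hft := hf t hKt
  set ε := t ^ (-l) with hε
  have hfp := hfpos t hKt
  have hmain := abs_setIntegral_ball_sub_le (a := ρ (qbar ^ 2) * qbar)
    (D := (M + 2 * L) * b + L * (C₀ * ε) ^ 2) hfp.le (hflux t hKt) (by positivity) (by
      intro x hx
      have h1 := hsub (x, t) hKt
      have h2 := hrate (x, t) hKt
      rw [Real.sqrt_le_left (by norm_num), Fin.sum_univ_three] at h1
      rw [Real.sqrt_le_left (by positivity)] at h2
      rw [Fin.sum_univ_three]
      refine abs_flux_sub_le hLpos.le hlip hM hq0.le hq1.le ⟨by positivity, by linarith⟩ ?_ ?_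
        (hb x hx)
      · exact abs_le_one_iff_mul_self_le_one.mpr (by nlinarith)
      · rw [abs_of_nonneg (by nlinarith)]
        nlinarith)
  have hlow : Real.pi * (A * ε) ≤
      |Real.pi * fbar ^ 2 * ρ (qbar ^ 2) * qbar - Real.pi * f t ^ 2 * (ρ (qbar ^ 2) * qbar)| := by
    rw [show Real.pi * fbar ^ 2 * ρ (qbar ^ 2) * qbar - Real.pi * f t ^ 2 * (ρ (qbar ^ 2) * qbar)
      = -(Real.pi * (ρ (qbar ^ 2) * qbar) * (c * ε) * (f t + fbar)) by rw [hft]; ring,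
      abs_neg, abs_mul, abs_mul, abs_mul c, abs_of_pos hεpos, abs_of_pos (add_pos hfp hfbar),
      abs_of_pos (by positivity)]
    have : 0 ≤ Real.pi * (ρ (qbar ^ 2) * qbar) * (|c| * ε) * f t := by positivity
    rw [hA]
    linarith
  have hAF : A * ε ≤ f t ^ 2 * ((M + 2 * L) * b + L * (C₀ * ε) ^ 2) := by
    have := hlow.trans hmain
    rw [mul_assoc Real.pi] at this
    exact le_of_mul_le_mul_left this Real.pi_pos
  have hfF : f t ≤ F := by
    rw [hft, hF]
    nlinarith [le_abs_self c]
  have hb0 : 0 ≤ b := (abs_nonneg _).trans (hb 0 (Metric.mem_ball_self hfp))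
  have hF2 : A * ε ≤ F ^ 2 * ((M + 2 * L) * b + L * (C₀ * ε) ^ 2) :=
    hAF.trans (by gcongr)
  rw [le_div_iff₀ (by positivity)] at hε2
  rw [div_mul_eq_mul_div, div_le_iff₀ (by positivity)]
  nlinarith [mul_le_mul_of_nonneg_left hε2 hεpos.le]
end
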